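/- The norm-comparison constant C_{7,3} equals √7; that is, every nonzero 3-covector φ on ℝ⁷ satisfies |φ|* ≤ √7 · ‖φ‖*, and there exists a nonzero 3-covector φ on ℝ⁷ with |φ|* = √7 · ‖φ‖*. -/

import Mathlib

open scoped Classical

/-- A `p`-covector on `ℝⁿ`: a continuous alternating `p`-linear form on
`EuclideanSpace ℝ (Fin n)`. -/
abbrev Covector (n p : ℕ) := EuclideanSpace ℝ (Fin n) [⋀^Fin p]→L[ℝ] ℝ

/-- The comass of a real-valued function of `p` vectors in `ℝⁿ`: the supremum of
its absolute values on orthonormal families. -/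
noncomputable def comassFun {n p : ℕ}
    (F : (Fin p → EuclideanSpace ℝ (Fin n)) → ℝ) : ℝ :=
  sSup {r : ℝ | ∃ v : Fin p → EuclideanSpace ℝ (Fin n), Orthonormal ℝ v ∧ r = |F v|}

/-- The comass norm `‖φ‖*` of a `p`-covector. -/
noncomputable def comass {n p : ℕ} (φ : Covector n p) : ℝ :=
  comassFun (fun v => φ v)

/-- The Euclidean norm `|φ|*` of a `p`-covector, computed from its coefficients
on the standard orthonormal basis, indexed by strictly increasing multi-indices. -/
noncomputable def euclNorm {n p : ℕ} (φ : Covector n p) : ℝ :=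
  Real.sqrt (∑ f : {f : Fin p → Fin n // StrictMono f},
    (φ (fun i => EuclideanSpace.single (f.1 i) 1)) ^ 2)

/-- The norm-comparison constant `C_{n,p}`: the supremum of `|φ|*/‖φ‖*` over all
nonzero `p`-covectors on `ℝⁿ`. -/
noncomputable def normComparisonConst (n p : ℕ) : ℝ :=
  sSup {r : ℝ | ∃ φ : Covector n p, φ ≠ 0 ∧ r = euclNorm φ / comass φ}

/-- The 3×3 minor of the coordinates `i, j, k`. -/
noncomputable def g2minor (i j k : Fin 7) (v : Fin 3 → EuclideanSpace ℝ (Fin 7)) : ℝ :=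
  v 0 i * (v 1 j * v 2 k - v 1 k * v 2 j) - v 0 j * (v 1 i * v 2 k - v 1 k * v 2 i)
    + v 0 k * (v 1 i * v 2 j - v 1 j * v 2 i)

lemma fin3_ne_01 : (0 : Fin 3) ≠ 1 := by decide

lemma fin3_ne_02 : (0 : Fin 3) ≠ 2 := by decide

lemma fin3_ne_12 : (1 : Fin 3) ≠ 2 := by decide

lemma fin3_cases (l : Fin 3) : l = 0 ∨ l = 1 ∨ l = 2 := by
  fin_cases l <;> simp

/-- The elementary 3-covector `dx_i ∧ dx_j ∧ dx_k`. -/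
noncomputable def g2elem (i j k : Fin 7) : Covector 7 3 where
  toFun := g2minor i j k
  map_update_add' := by
    intro inst m l x y
    rcases fin3_cases l with rfl | rfl | rfl <;>
      simp only [g2minor, Function.update_self, Function.update_of_ne fin3_ne_01,
        Function.update_of_ne fin3_ne_01.symm, Function.update_of_ne fin3_ne_02, Function.update_of_ne fin3_ne_02.symm,
        Function.update_of_ne fin3_ne_12, Function.update_of_ne fin3_ne_12.symm, PiLp.add_apply,
        PiLp.smul_apply, smul_eq_mul] <;> ring
  map_update_smul' := by
    intro inst m l c x
    rcases fin3_cases l with rfl | rfl | rfl <;>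
      simp only [g2minor, Function.update_self, Function.update_of_ne fin3_ne_01,
        Function.update_of_ne fin3_ne_01.symm, Function.update_of_ne fin3_ne_02, Function.update_of_ne fin3_ne_02.symm,
        Function.update_of_ne fin3_ne_12, Function.update_of_ne fin3_ne_12.symm, PiLp.add_apply,
        PiLp.smul_apply, smul_eq_mul] <;> ring
  cont := by
    unfold g2minor
    fun_prop
  map_eq_zero_of_eq' := by
    intro v a b h hab
    fin_cases a <;> fin_cases b <;> simp [g2minor] at h hab ⊢ <;> rw [h] <;> ring

/-- The associative 3-form. -/
noncomputable def g2form : Covector 7 3 :=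
  g2elem 0 1 2 + g2elem 0 3 4 + g2elem 0 5 6 + g2elem 1 3 5 - g2elem 1 4 6 - g2elem 2 3 6
    - g2elem 2 4 5

lemma g2form_apply (v : Fin 3 → EuclideanSpace ℝ (Fin 7)) : g2form v =
    g2minor 0 1 2 v + g2minor 0 3 4 v + g2minor 0 5 6 v + g2minor 1 3 5 v - g2minor 1 4 6 v
      - g2minor 2 3 6 v - g2minor 2 4 5 v := rfl

lemma bdd_comass (φ : Covector 7 3) :
    BddAbove {r : ℝ | ∃ v : Fin 3 → EuclideanSpace ℝ (Fin 7), Orthonormal ℝ v ∧ r = |φ v|} := by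
  refine ⟨‖φ‖, ?_⟩
  rintro r ⟨v, hv, rfl⟩
  have := φ.le_opNorm v
  simpa [hv.1] using this

lemma le_comass (φ : Covector 7 3) (v : Fin 3 → EuclideanSpace ℝ (Fin 7))
    (hv : Orthonormal ℝ v) : |φ v| ≤ comass φ :=
  le_csSup (bdd_comass φ) ⟨v, hv, rfl⟩

lemma comass_nonneg' (φ : Covector 7 3) : 0 ≤ comass φ := by
  apply Real.sSup_nonneg
  rintro r ⟨v, hv, rfl⟩
  exact abs_nonneg _

/-- Coefficients. -/
noncomputable def coef (φ : Covector 7 3) (i j k : Fin 7) : ℝ :=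
  φ ![EuclideanSpace.single i 1, EuclideanSpace.single j 1, EuclideanSpace.single k 1]

lemma coef_swap01 (φ : Covector 7 3) (i j k : Fin 7) : coef φ i j k = - coef φ j i k := by
  have := φ.toAlternatingMap.map_swap
    ![EuclideanSpace.single j 1, EuclideanSpace.single i 1, EuclideanSpace.single k 1]
    (i := 0) (j := 1) (by decide)
  unfold coef
  simp only [ContinuousAlternatingMap.coe_toAlternatingMap] at this
  rw [← this]
  congr 1
  ext l : 1
  fin_cases l <;> rfl

lemma coef_swap12 (φ : Covector 7 3) (i j k : Fin 7) : coef φ i j k = - coef φ i k j := by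
  have := φ.toAlternatingMap.map_swap
    ![EuclideanSpace.single i 1, EuclideanSpace.single k 1, EuclideanSpace.single j 1]
    (i := 1) (j := 2) (by decide)
  unfold coef
  simp only [ContinuousAlternatingMap.coe_toAlternatingMap] at this
  rw [← this]
  congr 1
  ext l : 1
  fin_cases l <;> rfl

lemma coef_diag (φ : Covector 7 3) (i k : Fin 7) : coef φ i i k = 0 := by
  linarith [coef_swap01 φ i i k]

lemma coef_diag' (φ : Covector 7 3) (i k : Fin 7) : coef φ i k k = 0 := by
  linarith [coef_swap12 φ i k k]

lemma coef_diag'' (φ : Covector 7 3) (i k : Fin 7) : coef φ i k i = 0 := by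
  rw [coef_swap12, coef_diag, neg_zero]

/-- The Euclidean norm in coordinates. -/
lemma eucl_sum (φ : Covector 7 3) :
    (∑ f : {f : Fin 3 → Fin 7 // StrictMono f},
      (φ (fun i => EuclideanSpace.single (f.1 i) 1)) ^ 2)
    = ∑ i, ∑ j, ∑ k, if i < j ∧ j < k then coef φ i j k ^ 2 else 0 := by
  have h1 : (∑ f : {f : Fin 3 → Fin 7 // StrictMono f},
      (φ (fun i => EuclideanSpace.single (f.1 i) 1)) ^ 2)
      = ∑ f : Fin 3 → Fin 7, if StrictMono f then
        (φ (fun i => EuclideanSpace.single (f i) 1)) ^ 2 else 0 := by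
    rw [← Finset.sum_filter]
    exact (Finset.sum_subtype _ (by simp) 
      (fun f : Fin 3 → Fin 7 => (φ (fun i => EuclideanSpace.single (f i) 1)) ^ 2)).symm
  rw [h1]
  simp only [← Fintype.sum_prod_type']
  let e : (Fin 7 × Fin 7 × Fin 7) ≃ (Fin 3 → Fin 7) :=
    { toFun := fun x => ![x.1, x.2.1, x.2.2]
      invFun := fun f => (f 0, f 1, f 2)
      left_inv := fun x => rfl
      right_inv := fun f => by ext l : 1; fin_cases l <;> rfl }
  symm
  refine Fintype.sum_equiv e _ _ ?_
  rintro ⟨i, j, k⟩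
  have h2 : StrictMono ![i, j, k] ↔ i < j ∧ j < k := by
    rw [Fin.strictMono_iff_lt_succ]
    simp [Fin.forall_fin_two]
  change _ = if StrictMono ![i, j, k] then
    (φ (fun l => EuclideanSpace.single (![i, j, k] l) 1)) ^ 2 else 0
  simp only [h2]
  split_ifs
  · unfold coef
    congr 2
    ext l : 1
    fin_cases l <;> rfl
  · rfl

lemma row_le (φ : Covector 7 3) (i j : Fin 7) (hij : i ≠ j) :
    ∑ k, coef φ i j k ^ 2 ≤ comass φ ^ 2 := by
  set v : EuclideanSpace ℝ (Fin 7) := WithLp.toLp 2 (fun k => coef φ i j k) with hv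
  have hvk : ∀ k, v k = coef φ i j k := fun k => rfl
  have hn : ‖v‖ ^ 2 = ∑ k, coef φ i j k ^ 2 := by
    rw [EuclideanSpace.norm_sq_eq]; simp [hvk]
  rw [← hn]
  by_cases h0 : v = 0
  · rw [h0]; simp; positivity
  have hpos : 0 < ‖v‖ := norm_pos_iff.2 h0
  let L := φ.toContinuousLinearMap
    ![EuclideanSpace.single i 1, EuclideanSpace.single j 1, 0] 2
  have hL : ∀ w, L w = φ ![EuclideanSpace.single i 1, EuclideanSpace.single j 1, w] := by
    intro w
    change φ (Function.update _ _ _) = _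
    congr 1
    ext l : 1
    fin_cases l <;> simp
  have hLv : L v = ‖v‖ ^ 2 := by
    have hs : v = ∑ k, v k • EuclideanSpace.single k (1 : ℝ) := by
      ext l
      simp [Finset.sum_apply, Pi.single_apply]
    rw [hs, map_sum, ← hs, hn]
    refine Finset.sum_congr rfl fun k _ => ?_
    rw [map_smul, hL, hvk, smul_eq_mul, sq]
    rfl
  have ho : Orthonormal ℝ
      ![EuclideanSpace.single i 1, EuclideanSpace.single j 1, ‖v‖⁻¹ • v] := by
    have hi : v i = 0 := by rw [hvk, coef_diag'']
    have hj : v j = 0 := by rw [hvk, coef_diag']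
    constructor
    · intro l
      fin_cases l
      · simp
      · simp
      · simp [norm_smul, hpos.ne']
    · intro a b hab
      fin_cases a <;> fin_cases b <;>
        simp [hij, hij.symm, hi, hj, inner_smul_left, inner_smul_right,
          EuclideanSpace.inner_single_left, EuclideanSpace.inner_single_right] at hab ⊢
  have h1 := le_comass φ _ ho
  rw [← hL, map_smul, hLv, smul_eq_mul] at h1
  have h2 : ‖v‖⁻¹ * ‖v‖ ^ 2 = ‖v‖ := by field_simp
  rw [h2, abs_of_pos hpos] at h1
  gcongr

lemma sum_all (φ : Covector 7 3) :
    ∑ i, ∑ j, ∑ k, coef φ i j k ^ 2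
    = 6 * ∑ i, ∑ j, ∑ k, if i < j ∧ j < k then coef φ i j k ^ 2 else 0 := by
  set F : Fin 7 → Fin 7 → Fin 7 → ℝ :=
    fun i j k => if i < j ∧ j < k then coef φ i j k ^ 2 else 0 with hF
  have s01 : ∀ i j k, coef φ i j k ^ 2 = coef φ j i k ^ 2 := fun i j k => by
    rw [coef_swap01, neg_sq]
  have s12 : ∀ i j k, coef φ i j k ^ 2 = coef φ i k j ^ 2 := fun i j k => by
    rw [coef_swap12, neg_sq]
  have key : ∀ i j k, coef φ i j k ^ 2 =
      F i j k + F i k j + F j i k + F j k i + F k i j + F k j i := by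
    intro i j k
    have e1 := s12 i j k
    have e2 := s01 i j k
    have e3 := s12 j i k
    have e4 := s01 i k j
    have e5 := s12 k i j
    simp only [hF, ← e5, ← e4, ← e3, ← e2, ← e1]
    rcases lt_trichotomy i j with h | h | h
    · rcases lt_trichotomy j k with h' | h' | h'
      · simp [h, h', h.not_gt, h'.not_gt, (h.trans h').not_gt]
      · subst h'; simp [coef_diag']
      · rcases lt_trichotomy i k with h'' | h'' | h''
        · simp [h, h', h'', h.not_gt, h'.not_gt, h''.not_gt]
        · subst h''; simp [coef_diag'']
        · simp [h, h', h'', h.not_gt, h'.not_gt, h''.not_gt]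
    · subst h; simp [coef_diag]
    · rcases lt_trichotomy j k with h' | h' | h'
      · rcases lt_trichotomy i k with h'' | h'' | h''
        · simp [h, h', h'', h.not_gt, h'.not_gt, h''.not_gt]
        · subst h''; simp [coef_diag'']
        · simp [h, h', h'', h.not_gt, h'.not_gt, h''.not_gt]
      · subst h'; simp [coef_diag']
      · simp [h, h', h.not_gt, h'.not_gt, (h'.trans h).not_gt]
  have c1 : ∀ G : Fin 7 → Fin 7 → Fin 7 → ℝ,
      ∑ i, ∑ j, ∑ k, G i k j = ∑ i, ∑ j, ∑ k, G i j k := fun G =>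
    Finset.sum_congr rfl fun i _ => Finset.sum_comm
  have c2 : ∀ G : Fin 7 → Fin 7 → Fin 7 → ℝ,
      ∑ i, ∑ j, ∑ k, G j i k = ∑ i, ∑ j, ∑ k, G i j k := fun G => Finset.sum_comm
  change _ = 6 * ∑ i, ∑ j, ∑ k, F i j k
  clear_value F
  simp only [key, Finset.sum_add_distrib]
  have d1 := c1 F
  have d2 := c2 F
  have d3 := c1 (fun i j k => F j i k)
  have d4 := c2 (fun i j k => F i k j)
  have d5 := c2 (fun i j k => F k i j)
  linarith

lemma eucl_le (φ : Covector 7 3) : euclNorm φ ≤ Real.sqrt 7 * comass φ := by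
  have h : ∑ i, ∑ j, ∑ k, coef φ i j k ^ 2 ≤ 42 * comass φ ^ 2 := by
    calc ∑ i, ∑ j, ∑ k, coef φ i j k ^ 2
        ≤ ∑ i : Fin 7, ∑ j : Fin 7, if i = j then 0 else comass φ ^ 2 := by
          refine Finset.sum_le_sum fun i _ => Finset.sum_le_sum fun j _ => ?_
          split_ifs with hij
          · subst hij; simp [coef_diag]
          · exact row_le φ i j hij
      _ = 42 * comass φ ^ 2 := by
          simp [Fin.sum_univ_seven]
          ring
  rw [sum_all, ← eucl_sum] at h
  unfold euclNorm
  rw [Real.sqrt_le_left (mul_nonneg (Real.sqrt_nonneg _) (comass_nonneg' φ)), mul_pow,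
    Real.sq_sqrt (by norm_num)]
  linarith

lemma g2_comass_le : comass g2form ≤ 1 := by
  apply Real.sSup_le _ zero_le_one
  rintro r ⟨v, hv, rfl⟩
  have h0 := hv.1 0
  have h1 := hv.1 1
  have h2 := hv.1 2
  have h01 := hv.2 (show (0 : Fin 3) ≠ 1 by decide)
  have n0 : ‖v 0‖ ^ 2 = 1 := by rw [h0]; norm_num
  have n1 : ‖v 1‖ ^ 2 = 1 := by rw [h1]; norm_num
  have n2 : ‖v 2‖ ^ 2 = 1 := by rw [h2]; norm_num
  rw [EuclideanSpace.norm_sq_eq] at n0 n1 n2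
  simp only [Real.norm_eq_abs, sq_abs, Fin.sum_univ_seven] at n0 n1 n2
  simp only [PiLp.inner_apply, Fin.sum_univ_seven, RCLike.inner_apply, conj_trivial] at h01
  have hx : ∃ c : Fin 7 → ℝ, (∑ k, c k ^ 2 = 1) ∧ g2form v = ∑ k, c k * v 2 k := by
    refine ⟨fun k => g2form ![v 0, v 1, EuclideanSpace.single k 1], ?_, ?_⟩
    · simp only [Fin.sum_univ_seven, g2form_apply, g2minor]
      simp
      generalize v 0 = x at *
      generalize v 1 = y at *
      have : (1 : ℝ) = (x 0 ^ 2 + x 1 ^ 2 + x 2 ^ 2 + x 3 ^ 2 + x 4 ^ 2 + x 5 ^ 2 + x 6 ^ 2) *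
        (y 0 ^ 2 + y 1 ^ 2 + y 2 ^ 2 + y 3 ^ 2 + y 4 ^ 2 + y 5 ^ 2 + y 6 ^ 2) -
        (y 0 * x 0 + y 1 * x 1 + y 2 * x 2 + y 3 * x 3 + y 4 * x 4 + y 5 * x 5 + y 6 * x 6) ^ 2 := by
        rw [n0, n1, h01]; norm_num
      rw [this]
      ring
    · simp only [Fin.sum_univ_seven, g2form_apply, g2minor]
      simp
      ring
  obtain ⟨c, hc, he⟩ := hx
  change |g2form v| ≤ 1
  rw [← sq_le_one_iff_abs_le_one, he]
  refine (Finset.sum_mul_sq_le_sq_mul_sq _ _ _).trans ?_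
  rw [hc, Fin.sum_univ_seven, n2]
  norm_num

lemma g2_eucl : euclNorm g2form = Real.sqrt 7 := by
  unfold euclNorm
  rw [eucl_sum]
  congr 1
  simp only [Fin.sum_univ_seven, coef, g2form_apply, g2minor]
  simp
  norm_num

/-- `C_{7,3} = √7`. -/
theorem C_seven_three_eq_sqrt_seven :
    (∀ φ : Covector 7 3, φ ≠ 0 → euclNorm φ ≤ Real.sqrt 7 * comass φ) ∧
    (∃ φ : Covector 7 3, φ ≠ 0 ∧ euclNorm φ = Real.sqrt 7 * comass φ) := by
  refine ⟨fun φ _ => eucl_le φ, g2form, ?_, ?_⟩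
  · intro h
    have h1 := g2_eucl
    rw [h] at h1
    have h2 : (0 : ℝ) < Real.sqrt 7 := by positivity
    simp [euclNorm] at h1
    rw [← h1] at h2
    exact lt_irrefl _ h2
  · apply le_antisymm (eucl_le _)
    rw [g2_eucl]
    have := mul_le_mul_of_nonneg_left g2_comass_le (Real.sqrt_nonneg 7)
    linarith
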